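/- arXiv:math/0703807 — 2 statements merged into one kernel-verified Lean document; each statement's English description precedes it below -/
import Mathlib

section
/- For a subset E of ℝⁿ (n ≥ 2) that is Carathéodory-measurable with respect to the tube-measure μ, either μ(E) = 0 or μ(ℝⁿ \ E) = 0. Consequently, the only tube-measurable sets are the tube-null sets and their complements. -/
open MeasureTheory Metric Set

/-- Volume of the unit ball of `ℝ^k` (with `k = n-1` this is `γ_{n-1}`). -/
noncomputable def unitBallVolume (k : ℕ) : ENNReal :=
  volume (Metric.closedBall (0 : EuclideanSpace ℝ (Fin k)) 1)

/-- `T` is a tube of cross-sectional radius `r > 0` in `ℝ^n`: the closed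
`r`-neighbourhood of some affine line. -/
def IsTube {n : ℕ} (T : Set (EuclideanSpace ℝ (Fin n))) (r : ℝ) : Prop :=
  0 < r ∧ ∃ p v : EuclideanSpace ℝ (Fin n), v ≠ 0 ∧
    T = Metric.cthickening r {x | ∃ t : ℝ, x = p + t • v}

/-- The tube-measure: infimum of `∑ γ_{n-1} rᵢ^{n-1}` over countable covers of `E`
by tubes of cross-sectional radii `rᵢ`. -/
noncomputable def tubeMeasure (n : ℕ) (E : Set (EuclideanSpace ℝ (Fin n))) : ENNReal :=
  ⨅ (T : ℕ → Set (EuclideanSpace ℝ (Fin n))) (r : ℕ → ℝ)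
    (_ : ∀ i, IsTube (T i) (r i)) (_ : E ⊆ ⋃ i, T i),
    ∑' i, unitBallVolume (n - 1) * ENNReal.ofReal (r i ^ (n - 1))

/-- `E` is Carathéodory-measurable with respect to the tube-measure. -/
def TubeMeasurable (n : ℕ) (E : Set (EuclideanSpace ℝ (Fin n))) : Prop :=
  ∀ A : Set (EuclideanSpace ℝ (Fin n)),
    tubeMeasure n A = tubeMeasure n (A ∩ E) + tubeMeasure n (A \ E)

abbrev EE (m : ℕ) := EuclideanSpace ℝ (Fin m)

lemma le_of_sq_le_sq' {a b : ℝ} (h : a^2 ≤ b^2) (hb : 0 ≤ b) : a ≤ b := (le_abs_self a).trans (abs_le_of_sq_le_sq h hb)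

lemma coords (m : ℕ) (v : EE (m+1)) (hv : v ≠ 0) :
    ∃ (a : EE (m+1) →ₗ[ℝ] ℝ) (q : EE (m+1) →ₗ[ℝ] EE m),
      (∀ x, ‖x‖^2 = (a x)^2 + ‖q x‖^2) ∧ q v = 0 ∧
      MeasurePreserving (fun x => (a x, q x)) volume volume := by
  have ho : Orthonormal ℝ (({0} : Set (Fin (m+1))).domRestrict (fun _ => (‖v‖⁻¹ • v : EE (m+1)))) := by
    refine ⟨fun i => ?_, fun i j hij => ?_⟩
    · have : ‖v‖ ≠ 0 := norm_ne_zero_iff.2 hv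
      change ‖‖v‖⁻¹ • v‖ = 1
      rw [norm_smul, norm_inv, norm_norm, inv_mul_cancel₀ this]
    · exact absurd (Subsingleton.elim i j) hij
  obtain ⟨b, hb⟩ := ho.exists_orthonormalBasis_extension_of_card_eq (by simp)
  have hb0 : b 0 = ‖v‖⁻¹ • v := hb 0 rfl
  have hvb : v = ‖v‖ • b 0 := by
    rw [hb0, smul_smul, mul_inv_cancel₀ (norm_ne_zero_iff.2 hv), one_smul]
  let q : EE (m+1) →ₗ[ℝ] EE m :=
    { toFun := fun x => WithLp.toLp 2 (fun i => b.repr x i.succ)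
      map_add' := by intro x y; ext i; simp
      map_smul' := by intro c x; ext i; simp }
  let a : EE (m+1) →ₗ[ℝ] ℝ :=
    { toFun := fun x => b.repr x 0
      map_add' := by intro x y; simp
      map_smul' := by intro c x; simp }
  refine ⟨a, q, ?_, ?_, ?_⟩
  · intro x
    rw [← b.repr.norm_map x, EuclideanSpace.norm_sq_eq, EuclideanSpace.norm_sq_eq, Fin.sum_univ_succ]
    simp [a, q]
  · rw [hvb, map_smul]
    ext i
    simp [q]
  · have h1 := b.measurePreserving_repr
    have h2 := PiLp.volume_preserving_ofLp (Fin (m+1))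
    have h3 := volume_preserving_piFinSuccAbove (fun _ : Fin (m+1) => ℝ) 0
    have h4 := PiLp.volume_preserving_toLp (Fin m)
    have h5 := (MeasurePreserving.id (volume : Measure ℝ)).prod h4
    have h6 := h5.comp (h3.comp (h2.comp h1))
    exact h6

def line {m : ℕ} (p v : EE m) : Set (EE m) := {x | ∃ t : ℝ, x = p + t • v}

lemma cyl_vol {m : ℕ} (a : EE (m+1) →ₗ[ℝ] ℝ) (q : EE (m+1) →ₗ[ℝ] EE m)
    (hm : MeasurePreserving (fun x => (a x, q x)) volume volume) (s h α : ℝ) (hs : 0 ≤ s)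
    (y : EE m) :
    volume {x | |a x - α| ≤ h ∧ ‖q x - y‖ ≤ s} =
      ENNReal.ofReal (2*h) * (unitBallVolume m * ENNReal.ofReal (s^m)) := by
  have : {x | |a x - α| ≤ h ∧ ‖q x - y‖ ≤ s} =
      (fun x => (a x, q x)) ⁻¹' (closedBall α h ×ˢ closedBall y s) := by
    ext x; simp [dist_eq_norm]
  rw [this, hm.measure_preimage
    (measurableSet_closedBall.prod measurableSet_closedBall).nullMeasurableSet]
  rw [Measure.volume_eq_prod, Measure.prod_prod, Real.volume_closedBall,
    Measure.addHaar_closedBall' _ _ hs, unitBallVolume, finrank_euclideanSpace_fin, mul_comm (volume _)]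

lemma tube_upper {m : ℕ} {T : Set (EE (m+1))} {s : ℝ} (hT : IsTube T s) (c : EE (m+1)) (R : ℝ) :
    volume (T ∩ closedBall c R) ≤
      ENNReal.ofReal (2*R) * (unitBallVolume m * ENNReal.ofReal (s^m)) := by
  obtain ⟨hs, p, v, hv, rfl⟩ := hT
  obtain ⟨a, q, hn, hq, hm⟩ := coords m v hv
  rw [← cyl_vol a q hm s R (a c) hs.le (q p)]
  have hqn : ∀ x, ‖q x‖ ≤ ‖x‖ := fun x => by
    apply le_of_sq_le_sq' _ (norm_nonneg x)
    nlinarith [hn x, sq_nonneg (a x)]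
  have han : ∀ x, |a x| ≤ ‖x‖ := fun x => by
    apply le_of_sq_le_sq' _ (norm_nonneg x)
    rw [sq_abs]
    nlinarith [hn x, sq_nonneg (‖q x‖)]
  apply measure_mono
  rintro x ⟨hx, hxc⟩
  refine ⟨?_, ?_⟩
  · rw [← map_sub]
    exact (han _).trans (by simpa [dist_eq_norm] using hxc)
  · have hne : {x | ∃ t : ℝ, x = p + t • v}.Nonempty := ⟨p, 0, by simp⟩
    have h1 : infDist x {x | ∃ t : ℝ, x = p + t • v} ≤ s := by
      rw [mem_cthickening_iff] at hx
      exact ENNReal.toReal_le_of_le_ofReal hs.le hx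
    refine le_trans ?_ h1
    rw [le_infDist hne]
    rintro _ ⟨t, rfl⟩
    have : q x - q p = q (x - (p + t • v)) := by simp [hq]
    rw [this, dist_eq_norm]
    exact hqn _

lemma tube_lower {m : ℕ} (p v : EE (m+1)) (hv : v ≠ 0) (r R : ℝ) (hr : 0 < r) (hR : r ≤ R) :
    ENNReal.ofReal (2*(R-r)) * (unitBallVolume m * ENNReal.ofReal (r^m)) ≤
      volume (cthickening r {x | ∃ t : ℝ, x = p + t • v} ∩ closedBall p R) := by
  obtain ⟨a, q, hn, hq, hm⟩ := coords m v hv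
  rw [← cyl_vol a q hm r (R-r) (a p) hr.le (q p)]
  apply measure_mono
  rintro x ⟨h1, h2⟩
  rw [← map_sub] at h1 h2
  refine ⟨?_, ?_⟩
  · have hav : a v ≠ 0 := by
      intro h
      have := hn v
      rw [h, hq] at this
      simp at this
      exact hv this
    apply mem_cthickening_of_dist_le x (p + (a (x-p) / a v) • v) _ _ (show _ ∈ {y | ∃ t : ℝ, y = p + t • v} from ⟨_, rfl⟩)
    rw [dist_eq_norm]
    have h3 := hn (x - (p + (a (x-p) / a v) • v))
    have h4 : x - (p + (a (x-p) / a v) • v) = (x - p) - (a (x-p) / a v) • v := by abel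
    rw [h4, map_sub a (x - p) (_ • v), map_smul a, map_sub q (x - p) (_ • v), map_smul q, hq, smul_eq_mul, div_mul_cancel₀ _ hav] at h3
    rw [h4]
    simp only [sub_self, smul_zero, sub_zero] at h3
    refine le_trans (le_of_sq_le_sq' ?_ (norm_nonneg _)) h2
    linarith
  · rw [mem_closedBall, dist_eq_norm]
    apply le_of_sq_le_sq' _ (by linarith)
    have h5 : (a (x-p))^2 ≤ (R-r)^2 := by
      rw [← sq_abs]; gcongr
    have h6 : ‖q (x-p)‖^2 ≤ r^2 := by gcongr
    rw [hn]
    nlinarith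

lemma tube_LB {m : ℕ} (A : Set (EE (m+1))) (c : EE (m+1)) (R : ℝ) (hR : 0 < R) :
    volume (A ∩ closedBall c R) ≤ ENNReal.ofReal (2*R) * tubeMeasure (m+1) A := by
  have h0 : ENNReal.ofReal (2*R) ≠ 0 := by simp [hR]
  rw [mul_comm, ← ENNReal.div_le_iff h0 ENNReal.ofReal_ne_top, tubeMeasure]
  refine le_iInf fun T => le_iInf fun r => le_iInf fun hT => le_iInf fun hA => ?_
  rw [ENNReal.div_le_iff h0 ENNReal.ofReal_ne_top, mul_comm, ← ENNReal.tsum_mul_left]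
  calc volume (A ∩ closedBall c R) ≤ volume (⋃ i, (T i ∩ closedBall c R)) := by
        apply measure_mono
        rw [← iUnion_inter]
        exact inter_subset_inter_left _ hA
    _ ≤ ∑' i, volume (T i ∩ closedBall c R) := measure_iUnion_le _
    _ ≤ _ := ENNReal.tsum_le_tsum fun i => tube_upper (hT i) c R

lemma tubeMeasure_mono {n : ℕ} {A B : Set (EE n)} (h : A ⊆ B) :
    tubeMeasure n A ≤ tubeMeasure n B := by
  refine le_iInf fun T => le_iInf fun r => le_iInf fun hT => le_iInf fun hB => ?_
  exact iInf_le_of_le T (iInf_le_of_le r (iInf_le_of_le hT (iInf_le_of_le (h.trans hB) le_rfl)))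

lemma tubeMeasure_le_cover {n : ℕ} {A : Set (EE n)} (T : ℕ → Set (EE n)) (r : ℕ → ℝ)
    (hT : ∀ i, IsTube (T i) (r i)) (hA : A ⊆ ⋃ i, T i) :
    tubeMeasure n A ≤ ∑' i, unitBallVolume (n - 1) * ENNReal.ofReal (r i ^ (n - 1)) :=
  iInf_le_of_le T (iInf_le_of_le r (iInf_le_of_le hT (iInf_le_of_le hA le_rfl)))

lemma ubv_ne_top (m : ℕ) : unitBallVolume m ≠ ⊤ := measure_closedBall_lt_top.ne

lemma ubv_pos (m : ℕ) : 0 < unitBallVolume m := measure_closedBall_pos _ _ one_pos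

lemma tubeMeasure_tube_le {m : ℕ} (hm : m ≠ 0) {T : Set (EE (m+1))} {r : ℝ} (hT : IsTube T r) :
    tubeMeasure (m+1) T ≤ unitBallVolume m * ENNReal.ofReal (r^m) := by
  apply ENNReal.le_of_forall_pos_le_add
  intro ε hε _
  have hg := ubv_ne_top m
  have hg0 := (ubv_pos m).ne'
  obtain ⟨d, hd, hds⟩ := ENNReal.exists_pos_sum_of_countable (ε := (ε : ENNReal) / unitBallVolume m)
    (by simp [ENNReal.div_eq_zero_iff, hε.ne', hg]) ℕ
  obtain ⟨hr, p, v, hv, hTe⟩ := hT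
  let ρ : ℕ → ℝ := fun i => min 1 (d i : ℝ)
  have hρ : ∀ i, 0 < ρ i := fun i => lt_min one_pos (by exact_mod_cast hd i)
  let r' : ℕ → ℝ := fun i => Nat.casesOn i r ρ
  let T' : ℕ → Set (EE (m+1)) := fun i => cthickening (r' i) {x | ∃ t : ℝ, x = p + t • v}
  have hT' : ∀ i, IsTube (T' i) (r' i) := by
    intro i
    refine ⟨?_, p, v, hv, rfl⟩
    cases i with
    | zero => exact hr
    | succ i => exact hρ i
  refine (tubeMeasure_le_cover T' r' hT' ?_).trans ?_
  · rw [hTe]; exact subset_iUnion T' 0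
  rw [tsum_eq_zero_add' ENNReal.summable]
  refine add_le_add le_rfl ?_
  rw [ENNReal.tsum_mul_left]
  have : ∑' i, ENNReal.ofReal (r' (i+1) ^ (m+1-1)) ≤ ∑' i, (d i : ENNReal) := by
    refine ENNReal.tsum_le_tsum fun i => ?_
    rw [← ENNReal.ofReal_coe_nnreal]
    apply ENNReal.ofReal_le_ofReal
    exact (pow_le_of_le_one (hρ i).le (min_le_left _ _) hm).trans (min_le_right _ _)
  calc _ ≤ unitBallVolume m * ((ε : ENNReal) / unitBallVolume m) :=
        mul_le_mul_right (this.trans hds.le) _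
    _ = ε := ENNReal.mul_div_cancel hg0 hg

lemma tubeMeasure_iUnion_null {n : ℕ} (A : ℕ → Set (EE n)) (h : ∀ k, tubeMeasure n (A k) = 0) :
    tubeMeasure n (⋃ k, A k) = 0 := by
  by_contra hne
  obtain ⟨d, hd, hds⟩ := ENNReal.exists_pos_sum_of_countable' hne ℕ
  have key : ∀ k, ∃ (T : ℕ → Set (EE n)) (r : ℕ → ℝ) (_ : ∀ i, IsTube (T i) (r i))
      (_ : A k ⊆ ⋃ i, T i),
      ∑' i, unitBallVolume (n - 1) * ENNReal.ofReal (r i ^ (n - 1)) < d k := by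
    intro k
    have := hd k
    rw [← h k, tubeMeasure] at this
    simpa only [iInf_lt_iff] using this
  choose T r hT hA hs using key
  have : tubeMeasure n (⋃ k, A k) ≤ ∑' k, d k := by
    let e := Nat.pairEquiv.symm
    refine (tubeMeasure_le_cover (fun i => T (e i).1 (e i).2) (fun i => r (e i).1 (e i).2)
      (fun i => hT _ _) ?_).trans ?_
    · refine iUnion_subset fun k x hx => ?_
      obtain ⟨i, hi⟩ := mem_iUnion.1 (hA k hx)
      refine mem_iUnion.2 ⟨e.symm (k, i), ?_⟩
      simpa using hi
    · rw [e.tsum_eq (fun z : ℕ × ℕ => unitBallVolume (n - 1) * ENNReal.ofReal (r z.1 z.2 ^ (n - 1))),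
        ENNReal.tsum_prod (f := fun k i => unitBallVolume (n - 1) * ENNReal.ofReal (r k i ^ (n - 1)))]
      exact ENNReal.tsum_le_tsum fun k => (hs k).le
  exact absurd hds (not_lt.2 this)

lemma null_case {m : ℕ} (hm : m ≠ 0) (E : Set (EE (m+1))) (hE : TubeMeasurable (m+1) E)
    (h0 : volume E = 0) : tubeMeasure (m+1) E = 0 := by
  obtain ⟨v, hv⟩ := exists_ne (0 : EE (m+1))
  let T : ℕ → Set (EE (m+1)) := fun k => cthickening ((k:ℝ)+1) {x | ∃ t : ℝ, x = 0 + t • v}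
  have hT : ∀ k, IsTube (T k) ((k:ℝ)+1) := fun k => ⟨by positivity, 0, v, hv, rfl⟩
  have hcov : E = ⋃ k, T k ∩ E := by
    rw [← iUnion_inter]
    refine (inter_eq_right.2 fun x _ => ?_).symm
    obtain ⟨k, hk⟩ := exists_nat_ge ‖x‖
    refine mem_iUnion.2 ⟨k, mem_cthickening_of_dist_le x 0 _ _ ⟨0, by simp⟩ ?_⟩
    rw [dist_zero_right]; linarith
  rw [hcov]
  apply tubeMeasure_iUnion_null
  intro k
  set r : ℝ := (k:ℝ)+1 with hrdef
  have hr : 0 < r := (hT k).1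
  set G := unitBallVolume m * ENNReal.ofReal (r^m) with hG
  have hGt : G ≠ ⊤ := ENNReal.mul_ne_top (ubv_ne_top m) ENNReal.ofReal_ne_top
  have hle := tubeMeasure_tube_le hm (hT k)
  have hmain := hE (T k)
  have hfin : tubeMeasure (m+1) (T k) ≠ ⊤ := ne_top_of_le_ne_top hGt hle
  have hfin1 : tubeMeasure (m+1) (T k ∩ E) ≠ ⊤ :=
    ne_top_of_le_ne_top hfin (tubeMeasure_mono inter_subset_left)
  have hfin2 : tubeMeasure (m+1) (T k \ E) ≠ ⊤ :=
    ne_top_of_le_ne_top hfin (tubeMeasure_mono sdiff_subset)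
  have hineq : ∀ R : ℝ, r ≤ R → 2*(R-r) * G.toReal ≤ 2*R*(tubeMeasure (m+1) (T k \ E)).toReal := by
    intro R hR
    have h1 := tube_lower 0 v hv r R hr hR
    have h2 := tube_LB (T k \ E) 0 R (hr.trans_le hR)
    have h3 : volume (T k ∩ closedBall 0 R) ≤ volume ((T k \ E) ∩ closedBall 0 R) := by
      calc _ ≤ volume (((T k \ E) ∩ closedBall 0 R) ∪ E) := by
            apply measure_mono
            rintro x ⟨hx, hx'⟩
            by_cases h : x ∈ E
            · exact Or.inr h
            · exact Or.inl ⟨⟨hx, h⟩, hx'⟩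
        _ ≤ _ := measure_union_le _ _
        _ = _ := by rw [h0, add_zero]
    have h4 := (h1.trans h3).trans h2
    have h5 := ENNReal.toReal_mono (ENNReal.mul_ne_top ENNReal.ofReal_ne_top hfin2) h4
    rwa [ENNReal.toReal_mul (b := unitBallVolume m * ENNReal.ofReal (r^m)), ENNReal.toReal_mul (a := ENNReal.ofReal (2*R)), ENNReal.toReal_ofReal (by linarith),
      ENNReal.toReal_ofReal (by linarith)] at h5
  set x := (tubeMeasure (m+1) (T k ∩ E)).toReal with hx
  set y := (tubeMeasure (m+1) (T k \ E)).toReal with hy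
  have hxy : x + y ≤ G.toReal := by
    rw [hx, hy, ← ENNReal.toReal_add hfin1 hfin2, ← hmain]
    exact ENNReal.toReal_mono hGt hle
  have hx0 : 0 ≤ x := ENNReal.toReal_nonneg
  have hxz : x = 0 := by
    by_contra hne
    have hxp : 0 < x := lt_of_le_of_ne hx0 (Ne.symm hne)
    have hg0 : 0 ≤ G.toReal := ENNReal.toReal_nonneg
    have h8 : 0 ≤ r * G.toReal / x := by positivity
    have h6 := hineq (r + r * G.toReal / x + 1) (by linarith)
    have h7 : x * (r * G.toReal / x) = r * G.toReal := by field_simp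
    nlinarith [mul_nonneg h8 hx0]
  exact (ENNReal.toReal_eq_zero_iff _).1 hxz |>.resolve_right hfin1

lemma density_case {m : ℕ} (hm : m ≠ 0) (E : Set (EE (m+1))) (h0 : volume E ≠ 0) :
    ∃ x : EE (m+1), ∀ᶠ r : ℝ in nhdsWithin 0 (Ioi 0), ∀ v : EE (m+1), v ≠ 0 →
      (unitBallVolume m * ENNReal.ofReal (r^m)).toReal <
        2 * (tubeMeasure (m+1) (cthickening r {y | ∃ t : ℝ, y = x + t • v} ∩ E)).toReal := by
  have hne : (ae (volume.restrict E)).NeBot := by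
    rw [ae_neBot]
    intro h
    exact h0 (Measure.restrict_eq_zero.1 h)
  obtain ⟨x, hx⟩ := (Besicovitch.ae_tendsto_measure_inter_div (volume : Measure (EE (m+1))) E).exists
  refine ⟨x, ?_⟩
  set w := (volume (closedBall (0 : EE (m+1)) 1)).toReal with hw
  have hwp : 0 < w := ENNReal.toReal_pos (measure_closedBall_pos _ _ one_pos).ne'
    measure_closedBall_lt_top.ne
  set g := (unitBallVolume m).toReal with hg
  have hgp : 0 < g := ENNReal.toReal_pos (ubv_pos m).ne' (ubv_ne_top m)
  set δ := g / (w * 4^(m+1)) with hδ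
  have hδp : 0 < δ := by positivity
  have hev := hx.eventually (lt_mem_nhds (show ENNReal.ofReal (1-δ) < 1 by
    rw [ENNReal.ofReal_lt_one]; linarith))
  have h4 : Filter.Tendsto (fun r : ℝ => 4*r) (nhdsWithin 0 (Ioi 0)) (nhdsWithin 0 (Ioi 0)) := by
    apply tendsto_nhdsWithin_of_tendsto_nhds_of_eventually_within
    · have : Filter.Tendsto (fun r : ℝ => 4*r) (nhds 0) (nhds (4*0)) :=
        (continuous_const.mul continuous_id).tendsto 0
      rw [mul_zero] at this
      exact this.mono_left nhdsWithin_le_nhds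
    · filter_upwards [self_mem_nhdsWithin] with r hr
      have : (0:ℝ) < r := hr
      exact mem_Ioi.2 (by positivity)
  filter_upwards [h4.eventually hev, self_mem_nhdsWithin] with r hr hr0 v hv
  have hrp : (0:ℝ) < r := hr0
  set T := cthickening r {y | ∃ t : ℝ, y = x + t • v} with hTdef
  have hT : IsTube T r := ⟨hrp, x, v, hv, rfl⟩
  set B := closedBall x (4*r) with hB
  have hBt : volume B ≠ ⊤ := measure_closedBall_lt_top.ne
  have hb : (volume B).toReal = (4*r)^(m+1) * w := by
    rw [hB, Measure.addHaar_closedBall' _ _ (by positivity), ENNReal.toReal_mul,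
      ENNReal.toReal_ofReal (by positivity), finrank_euclideanSpace_fin]
  have hGt : unitBallVolume m * ENNReal.ofReal (r^m) ≠ ⊤ :=
    ENNReal.mul_ne_top (ubv_ne_top m) ENNReal.ofReal_ne_top
  have hfin : tubeMeasure (m+1) (T ∩ E) ≠ ⊤ :=
    ne_top_of_le_ne_top hGt ((tubeMeasure_mono inter_subset_left).trans (tubeMeasure_tube_le hm hT))
  have hlow := tube_lower x v hv r (4*r) hrp (by linarith)
  have hLB := tube_LB (T ∩ E) x (4*r) (by positivity)
  rw [← hTdef, ← hB] at hlow
  rw [← hB] at hLB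
  have hTm : MeasurableSet (T ∩ B) := (isClosed_cthickening.inter isClosed_closedBall).measurableSet
  have hsum : volume (E ∩ B) + volume (T ∩ B) ≤ volume ((T ∩ E) ∩ B) + volume B := by
    have h1 : volume (E ∩ B) ≤ volume ((T ∩ E) ∩ B) + volume (B \ (T ∩ B)) := by
      refine le_trans (measure_mono ?_) (measure_union_le _ _)
      rintro z ⟨hz, hz'⟩
      by_cases h : z ∈ T
      · exact Or.inl ⟨⟨h, hz⟩, hz'⟩
      · exact Or.inr ⟨hz', fun h' => h h'.1⟩
    calc _ ≤ _ := add_le_add_left h1 _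
      _ = volume ((T ∩ E) ∩ B) + (volume (B \ (T ∩ B)) + volume (T ∩ B)) := by rw [add_assoc]
      _ = _ := by rw [measure_sdiff inter_subset_right hTm.nullMeasurableSet (measure_ne_top_of_subset inter_subset_right hBt), tsub_add_cancel_of_le (measure_mono inter_subset_right)]
  have fE : volume (E ∩ B) ≠ ⊤ := measure_ne_top_of_subset inter_subset_right hBt
  have fT : volume (T ∩ B) ≠ ⊤ := measure_ne_top_of_subset inter_subset_right hBt
  have fS : volume ((T ∩ E) ∩ B) ≠ ⊤ := measure_ne_top_of_subset inter_subset_right hBt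
  have r1 := ENNReal.toReal_mono (ENNReal.add_ne_top.2 ⟨fS, hBt⟩) hsum
  rw [ENNReal.toReal_add fE fT, ENNReal.toReal_add fS hBt] at r1
  have r2 := ENNReal.toReal_mono fT hlow
  have r3 := ENNReal.toReal_mono (ENNReal.mul_ne_top ENNReal.ofReal_ne_top hfin) hLB
  rw [ENNReal.toReal_mul, ENNReal.toReal_ofReal (by linarith)] at r2 r3
  have hG : (unitBallVolume m * ENNReal.ofReal (r^m)).toReal = g * r^m := by
    rw [ENNReal.toReal_mul, ENNReal.toReal_ofReal (by positivity)]
  rw [hG] at r2 ⊢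
  have r4 : (1-δ) * (volume B).toReal ≤ (volume (E ∩ B)).toReal := by
    have := ENNReal.toReal_mono fE (ENNReal.mul_le_of_le_div hr.le)
    rw [ENNReal.toReal_mul] at this
    refine le_trans ?_ this
    gcongr
    rw [ENNReal.toReal_ofReal']
    exact le_max_left _ _
  have r5 : δ * (volume B).toReal = g * r^m * r := by
    rw [hb, hδ, mul_pow, pow_succ r m]; field_simp
  have hrm : 0 < g * r^m := by positivity
  set z := (tubeMeasure (m+1) (T ∩ E)).toReal
  have : 0 < r * (2 * z - g * r^m) := by nlinarith [mul_pos hrp hrm]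
  have := (mul_pos_iff_of_pos_left hrp).1 this
  linarith

/-- The only tube-measurable sets are the tube-null sets and their complements. -/
theorem tubeMeasurable_iff_null_or_conull (n : ℕ) (hn : 2 ≤ n)
    (E : Set (EuclideanSpace ℝ (Fin n))) (hE : TubeMeasurable n E) :
    tubeMeasure n E = 0 ∨ tubeMeasure n Eᶜ = 0 := by
  obtain ⟨m, rfl⟩ : ∃ m, n = m + 1 := ⟨n - 1, by omega⟩
  have hm : m ≠ 0 := by omega
  have hEc : TubeMeasurable (m+1) Eᶜ := by
    intro A
    rw [hE A, ← sdiff_eq, sdiff_compl, add_comm]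
  by_cases h1 : volume E = 0
  · exact Or.inl (null_case hm E hE h1)
  by_cases h2 : volume Eᶜ = 0
  · exact Or.inr (null_case hm Eᶜ hEc h2)
  exfalso
  obtain ⟨x, hx⟩ := density_case hm E h1
  obtain ⟨y, hy⟩ := density_case hm Eᶜ h2
  obtain ⟨r, ⟨hxr, hyr⟩, hr0⟩ := ((hx.and hy).and self_mem_nhdsWithin).exists
  have hr : (0:ℝ) < r := hr0
  obtain ⟨v, hv, s, hs⟩ : ∃ v : EE (m+1), v ≠ 0 ∧ ∃ s : ℝ, y = x + s • v := by
    by_cases hxy : y = x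
    · obtain ⟨v, hv⟩ := exists_ne (0 : EE (m+1))
      exact ⟨v, hv, 0, by simp [hxy]⟩
    · exact ⟨y - x, sub_ne_zero.2 hxy, 1, by simp⟩
  have hl : {z | ∃ t : ℝ, z = y + t • v} = {z | ∃ t : ℝ, z = x + t • v} := by
    ext z
    constructor
    · rintro ⟨t, rfl⟩
      exact ⟨s + t, by rw [hs, add_smul, add_assoc]⟩
    · rintro ⟨t, rfl⟩
      exact ⟨t - s, by rw [hs, sub_smul]; abel⟩
  have a1 := hxr v hv
  have a2 := hyr v hv
  rw [hl] at a2
  set T := cthickening r {z | ∃ t : ℝ, z = x + t • v}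
  have hT : IsTube T r := ⟨hr, x, v, hv, rfl⟩
  have hle := tubeMeasure_tube_le hm hT
  have hGt : unitBallVolume m * ENNReal.ofReal (r^m) ≠ ⊤ :=
    ENNReal.mul_ne_top (ubv_ne_top m) ENNReal.ofReal_ne_top
  have hfin := ne_top_of_le_ne_top hGt hle
  have f1 : tubeMeasure (m+1) (T ∩ E) ≠ ⊤ :=
    ne_top_of_le_ne_top hfin (tubeMeasure_mono inter_subset_left)
  have f2 : tubeMeasure (m+1) (T ∩ Eᶜ) ≠ ⊤ :=
    ne_top_of_le_ne_top hfin (tubeMeasure_mono inter_subset_left)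
  rw [hE T, sdiff_eq] at hle
  have := ENNReal.toReal_mono hGt hle
  rw [ENNReal.toReal_add f1 f2] at this
  linarith
end

section
/- No closed ball of positive radius in ℝⁿ (n ≥ 2) is Carathéodory-measurable with respect to the tube-measure μ: for every closed ball B of radius ρ > 0, both μ(B) > 0 and μ(ℝⁿ \ B) > 0, and B is not tube-measurable. In particular, Borel sets need not be tube-measurable. -/
open MeasureTheory Metric Set

noncomputable def tl {m : ℕ} (x : EuclideanSpace ℝ (Fin (m+1))) : EuclideanSpace ℝ (Fin m) :=
  WithLp.toLp 2 (fun i => x i.succ)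

lemma norm_sq_tl {m : ℕ} (x : EuclideanSpace ℝ (Fin (m+1))) : ‖x‖^2 = (x 0)^2 + ‖tl x‖^2 := by
  simp [EuclideanSpace.norm_sq_eq, Fin.sum_univ_succ, tl]

lemma norm_tl_le {m : ℕ} (x : EuclideanSpace ℝ (Fin (m+1))) : ‖tl x‖ ≤ ‖x‖ := by
  have := norm_sq_tl x
  exact le_of_sq_le_sq (by nlinarith [sq_nonneg (x 0)]) (norm_nonneg _)

lemma mp_F (m : ℕ) : MeasurePreserving
    (fun x : EuclideanSpace ℝ (Fin (m+1)) => (x 0, tl x)) volume volume := by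
  have h1 := EuclideanSpace.volume_preserving_symm_measurableEquiv_toLp (Fin (m+1))
  have h2 := volume_preserving_piFinSuccAbove (fun _ : Fin (m+1) => ℝ) 0
  have h3 := EuclideanSpace.volume_preserving_symm_measurableEquiv_toLp (Fin m) |>.symm
  have h4 := (MeasurePreserving.id (volume : Measure ℝ)).prod h3
  exact h4.comp (h2.comp h1)

lemma tl_add {m : ℕ} (x y : EuclideanSpace ℝ (Fin (m+1))) : tl (x + y) = tl x + tl y := by
  ext i; simp [tl]

lemma tl_sub {m : ℕ} (x y : EuclideanSpace ℝ (Fin (m+1))) : tl (x - y) = tl x - tl y := by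
  ext i; simp [tl]

lemma tl_smul {m : ℕ} (t : ℝ) (x : EuclideanSpace ℝ (Fin (m+1))) : tl (t • x) = t • tl x := by
  ext i; simp [tl]

lemma exists_rot {m : ℕ} (v : EuclideanSpace ℝ (Fin (m+1))) :
    ∃ Q : EuclideanSpace ℝ (Fin (m+1)) ≃ₗᵢ[ℝ] EuclideanSpace ℝ (Fin (m+1)), tl (Q v) = 0 := by
  have h : ‖v‖ = ‖EuclideanSpace.single (0 : Fin (m+1)) ‖v‖‖ := by simp
  refine ⟨_, (congrArg tl (Submodule.reflection_sub h)).trans ?_⟩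
  ext i
  simp [tl]

lemma vol_cyl {m : ℕ} (a b : ℝ) (z : EuclideanSpace ℝ (Fin m)) (r : ℝ) (hr : 0 ≤ r) :
    volume ((fun x : EuclideanSpace ℝ (Fin (m+1)) => (x 0, tl x)) ⁻¹'
      (Icc a b ×ˢ closedBall z r)) =
      ENNReal.ofReal (b - a) * (unitBallVolume m * ENNReal.ofReal (r ^ m)) := by
  rw [(mp_F m).measure_preimage
    ((measurableSet_Icc.prod measurableSet_closedBall).nullMeasurableSet)]
  rw [Measure.volume_eq_prod, Measure.prod_prod, Real.volume_Icc,
    Measure.addHaar_closedBall' volume z hr, unitBallVolume]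
  simp [mul_comm]

lemma vol_tube {m : ℕ} {T : Set (EuclideanSpace ℝ (Fin (m+1)))} {r : ℝ} (h : IsTube T r)
    (c : EuclideanSpace ℝ (Fin (m+1))) (ρ : ℝ) :
    volume (T ∩ closedBall c ρ) ≤
      ENNReal.ofReal (2 * ρ) * (unitBallVolume m * ENNReal.ofReal (r ^ m)) := by
  obtain ⟨hr, p, v, -, rfl⟩ := h
  obtain ⟨Q, hQ⟩ := exists_rot v
  have key : cthickening r {x | ∃ t : ℝ, x = p + t • v} ∩ closedBall c ρ ⊆
      Q ⁻¹' ((fun x : EuclideanSpace ℝ (Fin (m+1)) => (x 0, tl x)) ⁻¹'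
      (Icc (Q c 0 - ρ) (Q c 0 + ρ) ×ˢ closedBall (tl (Q p)) r)) := by
    rintro x ⟨hx, hxc⟩
    refine ⟨?_, ?_⟩
    · have h1 : ‖Q (x - c)‖ ≤ ρ := by
        rw [Q.norm_map, ← dist_eq_norm]; exact hxc
      have h2 : ‖(Q (x - c)) 0‖ ≤ ‖Q (x - c)‖ := PiLp.norm_apply_le _ _
      have h3 := abs_le.1 ((Real.norm_eq_abs _ ▸ h2).trans h1)
      simp only [map_sub, PiLp.sub_apply] at h3
      constructor <;> simp only <;> linarith [h3.1, h3.2]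
    · simp only [mem_closedBall]
      refine le_of_forall_pos_lt_add fun ε hε => ?_
      have := cthickening_subset_thickening' (by linarith : 0 < r + ε) (by linarith) _ hx
      obtain ⟨y, ⟨t, rfl⟩, hy⟩ := mem_thickening_iff.1 this
      have e : tl (Q x) - tl (Q p) = tl (Q (x - (p + t • v))) := by
        simp [map_sub, map_add, tl_sub, tl_add, tl_smul, hQ]
      rw [dist_eq_norm, e]
      refine (norm_tl_le _).trans_lt ?_
      rwa [Q.norm_map, ← dist_eq_norm]
  refine (measure_mono key).trans ?_
  rw [(LinearIsometryEquiv.measurePreserving Q).measure_preimage_emb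
    Q.toHomeomorph.measurableEmbedding, vol_cyl _ _ _ _ hr.le]
  apply le_of_eq; congr 2; ring

lemma vol_le_tubeMeasure {m : ℕ} (E : Set (EuclideanSpace ℝ (Fin (m+1))))
    (c : EuclideanSpace ℝ (Fin (m+1))) (ρ : ℝ) (hρ : 0 < ρ) :
    volume (E ∩ closedBall c ρ) ≤ ENNReal.ofReal (2 * ρ) * tubeMeasure (m+1) E := by
  have h0 : ENNReal.ofReal (2 * ρ) ≠ 0 := by simpa using hρ
  rw [mul_comm, ← ENNReal.div_le_iff_le_mul (Or.inl h0) (Or.inl ENNReal.ofReal_ne_top)]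
  simp only [tubeMeasure, le_iInf_iff]
  intro T r hT hE
  rw [ENNReal.div_le_iff_le_mul (Or.inl h0) (Or.inl ENNReal.ofReal_ne_top), mul_comm,
    ← ENNReal.tsum_mul_left]
  calc volume (E ∩ closedBall c ρ) ≤ volume (⋃ i, T i ∩ closedBall c ρ) := by
        rw [← iUnion_inter]; exact measure_mono (inter_subset_inter_left _ hE)
    _ ≤ ∑' i, volume (T i ∩ closedBall c ρ) := measure_iUnion_le _
    _ ≤ _ := ENNReal.tsum_le_tsum fun i => vol_tube (hT i) c ρ

lemma tube_upper_s8 {m : ℕ} (hm : 1 ≤ m) (p v : EuclideanSpace ℝ (Fin (m+1))) (hv : v ≠ 0) (δ : ℝ)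
    (hδ : 0 < δ) :
    tubeMeasure (m+1) (cthickening δ {x | ∃ t : ℝ, x = p + t • v}) ≤
      ENNReal.ofReal (4/3) * (unitBallVolume m * ENNReal.ofReal (δ ^ m)) := by
  refine (iInf₂_le (fun i : ℕ => cthickening (δ * (1/4)^i) {x | ∃ t : ℝ, x = p + t • v})
    (fun i : ℕ => δ * (1/4)^i)).trans ?_
  refine (iInf₂_le (fun i => ⟨by positivity, p, v, hv, rfl⟩) ?_).trans ?_
  · intro x hx
    exact mem_iUnion.2 ⟨0, by simpa using hx⟩
  · have hs : ∑' i : ℕ, ENNReal.ofReal ((1/4 : ℝ)^i) = ENNReal.ofReal (4/3) := by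
      rw [← ENNReal.ofReal_tsum_of_nonneg (fun i => by positivity)
        (summable_geometric_of_lt_one (by norm_num) (by norm_num)),
        tsum_geometric_of_lt_one (by norm_num) (by norm_num)]
      norm_num
    rw [← hs, ← ENNReal.tsum_mul_right]
    refine ENNReal.tsum_le_tsum fun i => ?_
    rw [mul_left_comm, ← ENNReal.ofReal_mul (by positivity)]
    simp only [Nat.add_sub_cancel]
    gcongr
    rw [mul_pow, mul_comm]
    gcongr
    exact pow_le_of_le_one (by positivity) (pow_le_one₀ (by norm_num) (by norm_num)) (by omega)

lemma cyl_sub {m : ℕ} (c : EuclideanSpace ℝ (Fin (m+1))) (ρ s : ℝ) (hρ : 0 < ρ) :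
    (fun x : EuclideanSpace ℝ (Fin (m+1)) => (x 0, tl x)) ⁻¹'
      (Icc (c 0 + s - 4/5*ρ) (c 0 + s + 4/5*ρ) ×ˢ closedBall (tl c) (3/5*ρ)) ⊆
    cthickening (3/5*ρ) {x | ∃ t : ℝ, x = c + t • EuclideanSpace.single (0 : Fin (m+1)) (1:ℝ)} ∩
    closedBall (c + s • EuclideanSpace.single (0 : Fin (m+1)) (1:ℝ)) ρ := by
  rintro x ⟨hx0, hx⟩
  simp only [mem_closedBall, dist_eq_norm, mem_Icc] at hx0 hx
  have ht : ∀ t : ℝ, tl (x - (c + t • EuclideanSpace.single (0 : Fin (m+1)) (1:ℝ))) = tl x - tl c := by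
    intro t; ext i; simp [tl]
  have h0 : ∀ t : ℝ, (x - (c + t • EuclideanSpace.single (0 : Fin (m+1)) (1:ℝ))) 0 = x 0 - c 0 - t := by
    intro t; simp; ring
  have hn : ∀ t : ℝ, ‖x - (c + t • EuclideanSpace.single (0 : Fin (m+1)) (1:ℝ))‖^2 =
      (x 0 - c 0 - t)^2 + ‖tl x - tl c‖^2 := by
    intro t; rw [norm_sq_tl, ht, h0]
  have hsq : ‖tl x - tl c‖^2 ≤ (3/5*ρ)^2 := by gcongr
  constructor
  · refine mem_cthickening_of_dist_le x _ _ _ ⟨x 0 - c 0, rfl⟩ ?_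
    rw [dist_eq_norm]
    refine le_of_sq_le_sq ?_ (by positivity)
    rw [hn]; simpa using hsq
  · rw [mem_closedBall, dist_eq_norm]
    refine le_of_sq_le_sq ?_ hρ.le
    rw [hn]
    have : (x 0 - c 0 - s)^2 ≤ (4/5*ρ)^2 := sq_le_sq' (by linarith [hx0.1]) (by linarith [hx0.2])
    nlinarith

/-- No closed ball of positive radius in `ℝ^n` (`n ≥ 2`) is tube-measurable: both
the ball and its complement have positive tube-measure, and the ball fails the
Carathéodory condition.  In particular, Borel sets need not be tube-measurable. -/
theorem closedBall_not_tubeMeasurable (n : ℕ) (hn : 2 ≤ n)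
    (c : EuclideanSpace ℝ (Fin n)) (ρ : ℝ) (hρ : 0 < ρ) :
    0 < tubeMeasure n (Metric.closedBall c ρ) ∧
    0 < tubeMeasure n (Metric.closedBall c ρ)ᶜ ∧
    ¬ TubeMeasurable n (Metric.closedBall c ρ) := by
  obtain ⟨m, rfl⟩ : ∃ m, n = m + 1 := ⟨n - 1, by omega⟩
  have hm : 1 ≤ m := by omega
  set e : EuclideanSpace ℝ (Fin (m+1)) := EuclideanSpace.single (0 : Fin (m+1)) (1:ℝ) with he
  have hen : ‖e‖ = 1 := by simp [he]
  have he0 : e ≠ 0 := by intro h; simp [h] at hen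
  have hdisj : closedBall (c + (3*ρ) • e) ρ ⊆ (closedBall c ρ)ᶜ := by
    intro x hx hx'
    simp only [mem_closedBall] at hx hx'
    have h1 : dist (c + (3*ρ) • e) c = 3*ρ := by
      simp [dist_eq_norm, norm_smul, hen, abs_of_pos hρ]
    have h2 := dist_triangle_left (c + (3*ρ) • e) c x
    linarith
  have hpos : ∀ E (c' : EuclideanSpace ℝ (Fin (m+1))), closedBall c' ρ ⊆ E →
      0 < tubeMeasure (m+1) E := by
    intro E c' h
    have h1 := vol_le_tubeMeasure E c' ρ hρ
    rw [inter_eq_self_of_subset_right h] at h1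
    have h2 := (measure_closedBall_pos volume c' hρ).trans_le h1
    exact pos_iff_ne_zero.2 (right_ne_zero_of_mul h2.ne')
  refine ⟨hpos _ c subset_rfl, hpos _ _ hdisj, fun hM => ?_⟩
  set T := cthickening (3/5*ρ) {x | ∃ t : ℝ, x = c + t • e} with hT
  set K := unitBallVolume m * ENNReal.ofReal ((3/5*ρ) ^ m) with hK
  have hK0 : K ≠ 0 := by
    refine mul_ne_zero (measure_closedBall_pos volume _ one_pos).ne' ?_
    have : 0 < (3/5*ρ)^m := by positivity
    simpa using this
  have hKt : K ≠ ⊤ := ENNReal.mul_ne_top measure_closedBall_lt_top.ne ENNReal.ofReal_ne_top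
  have hup := tube_upper_s8 hm c e he0 (3/5*ρ) (by positivity)
  have hlow : ∀ s : ℝ, ∀ E, T ∩ closedBall (c + s • e) ρ ⊆ E →
      ENNReal.ofReal (8/5*ρ) * K ≤ ENNReal.ofReal (2*ρ) * tubeMeasure (m+1) E := by
    intro s E hE
    refine le_trans ?_ (vol_le_tubeMeasure E (c + s • e) ρ hρ)
    have h1 := vol_cyl (c 0 + s - 4/5*ρ) (c 0 + s + 4/5*ρ) (tl c) (3/5*ρ) (by positivity)
    have h2 : c 0 + s + 4/5*ρ - (c 0 + s - 4/5*ρ) = 8/5*ρ := by ring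
    rw [h2] at h1
    rw [← h1]
    exact measure_mono ((cyl_sub c ρ s hρ).trans (subset_inter hE inter_subset_right))
  have l1 := hlow 0 (T ∩ closedBall c ρ) (by simp)
  have l2 := hlow (3*ρ) (T \ closedBall c ρ) (fun x hx => ⟨hx.1, hdisj hx.2⟩)
  have h := hM T
  have : ENNReal.ofReal (16/5*ρ) * K ≤ ENNReal.ofReal (8/3*ρ) * K := by
    calc ENNReal.ofReal (16/5*ρ) * K
        = ENNReal.ofReal (8/5*ρ) * K + ENNReal.ofReal (8/5*ρ) * K := by
          rw [← add_mul, ← ENNReal.ofReal_add (by positivity) (by positivity)]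
          congr 2; ring
      _ ≤ _ := add_le_add l1 l2
      _ = ENNReal.ofReal (2*ρ) * tubeMeasure (m+1) T := by rw [← mul_add, ← h]
      _ ≤ ENNReal.ofReal (2*ρ) * (ENNReal.ofReal (4/3) * K) := by gcongr
      _ = _ := by
          rw [← mul_assoc, ← ENNReal.ofReal_mul (by positivity)]
          congr 2; ring
  rw [ENNReal.mul_le_mul_iff_left hK0 hKt, ENNReal.ofReal_le_ofReal_iff (by positivity)] at this
  linarith
end
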